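/- If ρ is a permutation of the form ρ = (n-1)α n for some nonempty permutation α of {1,...,n-2}, then PSB^{-1}(Av(ρ)) = Av(B), where B = {(n-1)nα} ∪ {(n+1)(n-1)τ : τ is a shuffle of the one-element sequence (n) with α, τ ≠ nα}. -/

import Mathlib

/-- `π` is a permutation of `{1,…,n}`, encoded as the list of its values. -/
def IsPermList (n : ℕ) (π : List ℕ) : Prop := π.Perm (List.range' 1 n)

/-- The pattern `σ` occurs in `π`: some subsequence of `π` is order-isomorphic to `σ`. -/
def Contains (π σ : List ℕ) : Prop :=
  ∃ τ : List ℕ, τ.Sublist π ∧ τ.length = σ.length ∧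
    ∀ i j : ℕ, i < τ.length → j < τ.length → (τ[i]! < τ[j]! ↔ σ[i]! < σ[j]!)

/-- `π` avoids the pattern `σ`. -/
def Avoids (π σ : List ℕ) : Prop := ¬ Contains π σ

/-- The pop stack with bypass sorting procedure (algorithm PSB); the second
argument is the pop stack, stored top-first.  Push if the stack is empty or the
current element is `TOP - 1`; bypass if it is `< TOP - 1`; otherwise pop the
whole stack and push.  At the end the stack is popped. -/
def psbAux : List ℕ → List ℕ → List ℕ
  | [], s => s
  | x :: xs, [] => psbAux xs [x]
  | x :: xs, t :: s =>
      if x + 1 = t then psbAux xs (x :: t :: s)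
      else if x + 1 < t then x :: psbAux xs (t :: s)
      else (t :: s) ++ psbAux xs [x]

/-- The map associated with the PSB algorithm. -/
def psb (π : List ℕ) : List ℕ := psbAux π []

/-- `τ` is a shuffle of `ρ` and `σ`: it contains both as subsequences and no
other elements. -/
def IsShuffle (ρ σ τ : List ℕ) : Prop :=
  ρ.Sublist τ ∧ σ.Sublist τ ∧ τ.Perm (ρ ++ σ)

theorem contains_iff_exists_map (π σ : List ℕ) :
    Contains π σ ↔
      ∃ f : ℕ → ℕ, (∀ x ∈ σ, ∀ y ∈ σ, x < y → f x < f y) ∧ (σ.map f).Sublist π := by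
  constructor
  · rintro ⟨τ, hsub, hlen, h⟩
    have key : ∀ i (hi : i < σ.length), σ.idxOf σ[i] < σ.length ∧ σ[σ.idxOf σ[i]]! = σ[i] := by
      intro i hi
      have h1 : σ.idxOf σ[i] < σ.length := List.idxOf_lt_length_iff.2 (List.getElem_mem hi)
      exact ⟨h1, by rw [getElem!_pos σ _ h1]; exact List.getElem_idxOf h1⟩
    refine ⟨fun x => τ[σ.idxOf x]!, ?_, ?_⟩
    · intro x hx y hy hxy
      obtain ⟨i, hi, rfl⟩ := List.getElem_of_mem hx
      obtain ⟨j, hj, rfl⟩ := List.getElem_of_mem hy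
      obtain ⟨hi1, hi2⟩ := key i hi
      obtain ⟨hj1, hj2⟩ := key j hj
      rw [h _ _ (by omega) (by omega), hi2, hj2]
      exact hxy
    · convert hsub
      refine List.ext_getElem (by simp [hlen]) ?_
      intro i hi hi'
      simp only [List.length_map] at hi
      obtain ⟨hi1, hi2⟩ := key i hi
      have e1 := h i (σ.idxOf σ[i]) (by omega) (by omega)
      have e2 := h (σ.idxOf σ[i]) i (by omega) (by omega)
      rw [hi2, getElem!_pos σ i hi] at e1 e2
      rw [getElem!_pos τ i hi'] at e1 e2
      simp only [List.getElem_map]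
      simp only [lt_irrefl, iff_false] at e1 e2
      omega
  · rintro ⟨f, hf, hsub⟩
    refine ⟨σ.map f, hsub, by simp, ?_⟩
    intro i j hi hj
    rw [getElem!_pos _ i hi, getElem!_pos _ j hj]
    simp only [List.length_map] at hi hj
    rw [getElem!_pos σ i hi, getElem!_pos σ j hj]
    simp only [List.getElem_map]
    have hi' := List.getElem_mem hi
    have hj' := List.getElem_mem hj
    refine ⟨fun hlt => ?_, hf _ hi' _ hj'⟩
    by_contra hcon
    rcases (not_lt.1 hcon).eq_or_lt with he | hl
    · rw [he] at hlt
      exact lt_irrefl _ hlt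
    · exact absurd (hf _ hj' _ hi' hl) (by omega)

/-- Entries smaller than a value `b` that lies below the stack and never enters it are
output in the order in which they are read. -/
theorem filter_psbAux_of_lt_stack (b : ℕ) :
    ∀ l s : List ℕ, s ≠ [] → (∀ y ∈ s, b < y) → b ∉ l →
      (psbAux l s).filter (· < b) = l.filter (· < b) := by
  intro l
  induction l with
  | nil =>
    intro s _ hs _
    simp only [psbAux, List.filter_nil, List.filter_eq_nil_iff, decide_eq_true_eq]
    intro y hy
    have := hs y hy
    omega
  | cons x xs ih =>
    intro s hne hs hb
    rcases s with _ | ⟨t, s⟩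
    · exact absurd rfl hne
    have hbt : b < t := hs t (by simp)
    obtain ⟨hbx, hbxs⟩ : b ≠ x ∧ b ∉ xs := by simpa using hb
    have hs' : (t :: s).filter (· < b) = [] := by
      simp only [List.filter_eq_nil_iff, decide_eq_true_eq]
      intro y hy
      have := hs y hy
      omega
    rw [psbAux]
    split_ifs with h1 h2
    · rw [ih _ (by simp) (by
        intro y hy
        rcases List.mem_cons.1 hy with rfl | hy
        · omega
        · exact hs y hy) hbxs, List.filter_cons_of_neg (by simp; omega)]
    · rw [List.filter_cons, List.filter_cons, ih _ (by simp) hs hbxs]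
    · rw [List.filter_append, hs', ih [x] (by simp) (by simp; omega) hbxs,
        List.filter_cons_of_neg (by simp; omega), List.nil_append]

theorem exists_psbAux_eq_concat (b : ℕ) :
    ∀ l s : List ℕ, s ≠ [] → (∀ y ∈ s, b < y) → b ∉ l →
      ∃ Q M, psbAux l s = Q ++ [M] ∧ b < M := by
  intro l
  induction l with
  | nil =>
    intro s hne hs _
    exact ⟨s.dropLast, s.getLast hne, by simp [psbAux, List.dropLast_append_getLast],
      hs _ (List.getLast_mem hne)⟩
  | cons x xs ih =>
    intro s hne hs hb
    rcases s with _ | ⟨t, s⟩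
    · exact absurd rfl hne
    have hbt : b < t := hs t (by simp)
    obtain ⟨hbx, hbxs⟩ : b ≠ x ∧ b ∉ xs := by simpa using hb
    rw [psbAux]
    split_ifs with h1 h2
    · exact ih _ (by simp) (by
        intro y hy
        rcases List.mem_cons.1 hy with rfl | hy
        · omega
        · exact hs y hy) hbxs
    · obtain ⟨Q, M, h, hM⟩ := ih _ (by simp) hs hbxs
      exact ⟨x :: Q, M, by simp [h], hM⟩
    · obtain ⟨Q, M, h, hM⟩ := ih [x] (by simp) (by simp; omega) hbxs
      exact ⟨(t :: s) ++ Q, M, by simp [h], hM⟩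

theorem filter_lt_eq_self {b : ℕ} {A : List ℕ} (hA : ∀ a ∈ A, a < b) :
    A.filter (· < b) = A := by
  rw [List.filter_eq_self]
  simpa using hA

theorem sublist_of_sublist_psbAux {b : ℕ} {l s A : List ℕ} (hne : s ≠ [])
    (hs : ∀ y ∈ s, b < y) (hb : b ∉ l) (hA : ∀ a ∈ A, a < b)
    (h : A.Sublist (psbAux l s)) : A.Sublist l := by
  have := h.filter (· < b)
  rw [filter_lt_eq_self hA, filter_psbAux_of_lt_stack b l s hne hs hb] at this
  exact this.trans List.filter_sublist

theorem exists_concat_sublist_psbAux {b : ℕ} {l s A : List ℕ} (hne : s ≠ [])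
    (hs : ∀ y ∈ s, b < y) (hb : b ∉ l) (hA : ∀ a ∈ A, a < b)
    (h : A.Sublist l) : ∃ M, b < M ∧ (A ++ [M]).Sublist (psbAux l s) := by
  obtain ⟨Q, M, hQ, hM⟩ := exists_psbAux_eq_concat b l s hne hs hb
  have := h.filter (· < b)
  rw [filter_lt_eq_self hA, ← filter_psbAux_of_lt_stack b l s hne hs hb, hQ,
    List.filter_append, List.filter_cons_of_neg (by simp; omega), List.filter_nil,
    List.append_nil] at this
  exact ⟨M, hM, hQ ▸ (this.trans List.filter_sublist).append (List.Sublist.refl _)⟩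

/-- The state of the PSB procedure after reading a prefix `l` of the input. -/
theorem exists_psb_append (l : List ℕ) :
    ∃ out s, (∀ r, psb (l ++ r) = out ++ psbAux r s) ∧ s.Pairwise (· < ·) ∧
      (l ≠ [] → s ≠ []) ∧ (∀ y ∈ l, y ∈ out ∨ y ∈ s) ∧
      ∀ c, c ∉ l → ∀ d ∈ l, c < d → ∀ y ∈ s, c < y := by
  induction l using List.reverseRecOn with
  | nil => exact ⟨[], [], by simp [psb]⟩
  | append_singleton l x ih =>
    obtain ⟨out, s, hrun, hsort, hne, hmem, hgap⟩ := ih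
    rcases s with _ | ⟨t, s⟩
    · obtain rfl : l = [] := by
        by_contra h
        exact hne h rfl
      refine ⟨out, [x], ?_, by simp, by simp, by simp, by simp⟩
      intro r
      have := hrun (x :: r)
      simpa [psbAux] using this
    have hle : ∀ y ∈ t :: s, t ≤ y := by
      intro y hy
      rcases List.mem_cons.1 hy with rfl | hy
      · exact le_rfl
      · exact ((List.pairwise_cons.1 hsort).1 y hy).le
    have hstep : ∀ r, psb (l ++ [x] ++ r) = out ++ psbAux (x :: r) (t :: s) := by
      intro r
      rw [← hrun]
      simp
    rcases lt_trichotomy (x + 1) t with h | h | h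
    · refine ⟨out ++ [x], t :: s, ?_, hsort, by simp, ?_, ?_⟩
      · intro r
        rw [hstep, psbAux, if_neg (by omega), if_pos h]
        simp
      · intro y hy
        rcases List.mem_append.1 hy with hy | hy
        · rcases hmem y hy with h' | h'
          · simp [h']
          · exact Or.inr h'
        · simp_all
      · intro c hc d hd hcd y hy
        have := hle y hy
        simp only [List.mem_append, List.mem_singleton, not_or] at hc hd
        rcases hd with hd | rfl
        · exact hgap c hc.1 d hd hcd y hy
        · omega
    · refine ⟨out, x :: t :: s, ?_, ?_, by simp, ?_, ?_⟩
      · intro r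
        rw [hstep, psbAux, if_pos h]
      · refine List.pairwise_cons.2 ⟨fun y hy => ?_, hsort⟩
        have := hle y hy
        omega
      · intro y hy
        rcases List.mem_append.1 hy with hy | hy
        · rcases hmem y hy with h' | h'
          · exact Or.inl h'
          · exact Or.inr (List.mem_cons_of_mem _ h')
        · simp_all
      · intro c hc d hd hcd y hy
        simp only [List.mem_append, List.mem_singleton, not_or] at hc hd
        have hct : c < t := by
          rcases hd with hd | rfl
          · exact hgap c hc.1 d hd hcd t (by simp)
          · omega
        rcases List.mem_cons.1 hy with rfl | hy
        · omega
        · have := hle y hy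
          omega
    · refine ⟨out ++ (t :: s), [x], ?_, by simp, by simp, ?_, ?_⟩
      · intro r
        rw [hstep, psbAux, if_neg (by omega), if_neg (by omega)]
        simp
      · intro y hy
        rcases List.mem_append.1 hy with hy | hy
        · exact Or.inl (List.mem_append.2 (hmem y hy))
        · exact Or.inr hy
      · intro c hc d hd hcd y hy
        simp only [List.mem_append, List.mem_singleton, not_or] at hc hd hy
        subst hy
        rcases hd with hd | rfl
        · have := hgap c hc.1 d hd hcd t (by simp)
          omega
        · exact hcd

theorem exists_sublist_psb_of_ascent {π A : List ℕ} {b c : ℕ} (hnd : π.Nodup)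
    (hA : ∀ a ∈ A, a < b) (hbc : b < c) (h : (b :: c :: A).Sublist π) :
    ∃ M, b < M ∧ (b :: (A ++ [M])).Sublist (psb π) := by
  obtain ⟨l, r', rfl, hb, h'⟩ := List.cons_sublist_iff.1 h
  obtain ⟨l', r, rfl, hc, hr⟩ := List.cons_sublist_iff.1 h'
  obtain ⟨u, v, rfl⟩ := List.append_of_mem hc
  have hrw : l ++ (u ++ c :: v ++ r) = (l ++ u) ++ c :: (v ++ r) := by simp
  rw [hrw] at hnd ⊢
  have hA' : A.Sublist (v ++ r) := hr.trans (List.sublist_append_right _ _)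
  have hbl : b ∈ l ++ u := List.mem_append_left _ hb
  generalize l ++ u = p at *
  generalize v ++ r = q at *
  have hbq : b ∉ q := fun hq =>
    (List.nodup_append.1 hnd).2.2 b hbl b (List.mem_cons_of_mem _ hq) rfl
  obtain ⟨out, s, hrun, hsort, hne, hmem, -⟩ := exists_psb_append p
  rw [hrun]
  have hs0 : s ≠ [] := hne (List.ne_nil_of_mem hbl)
  rcases s with _ | ⟨t, s⟩
  · exact absurd rfl hs0
  have hle : ∀ y ∈ t :: s, t ≤ y := by
    intro y hy
    rcases List.mem_cons.1 hy with rfl | hy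
    · exact le_rfl
    · exact ((List.pairwise_cons.1 hsort).1 y hy).le
  have finish : ∀ o s', s' ≠ [] → (∀ y ∈ s', b < y) → b ∈ o →
      ∃ M, b < M ∧ (b :: (A ++ [M])).Sublist (o ++ psbAux q s') := by
    intro o s' hs' hlt ho
    obtain ⟨M, hM, hMs⟩ := exists_concat_sublist_psbAux hs' hlt hbq hA hA'
    exact ⟨M, hM, (List.singleton_sublist.2 ho).append hMs⟩
  rcases hmem b hbl with hbo | hbs
  · rw [psbAux]
    split_ifs with h1 h2
    · refine finish _ _ (by simp) (fun y hy => ?_) hbo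
      rcases List.mem_cons.1 hy with rfl | hy
      · exact hbc
      · have := hle y hy
        omega
    · obtain ⟨M, hM, hMs⟩ := finish (out ++ [c]) (t :: s) (by simp) (fun y hy => by
        have := hle y hy
        omega) (List.mem_append_left _ hbo)
      exact ⟨M, hM, by simpa using hMs⟩
    · obtain ⟨M, hM, hMs⟩ := finish (out ++ (t :: s)) [c] (by simp) (by simpa using hbc)
        (List.mem_append_left _ hbo)
      exact ⟨M, hM, by simpa using hMs⟩
  · have := hle b hbs
    rw [psbAux, if_neg (by omega), if_neg (by omega)]
    obtain ⟨M, hM, hMs⟩ := finish (out ++ (t :: s)) [c] (by simp) (by simpa using hbc)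
      (List.mem_append_right _ hbs)
    exact ⟨M, hM, by simpa using hMs⟩

theorem exists_sublist_psb_of_shuffle {π A₁ A₂ : List ℕ} {b c d : ℕ} (hnd : π.Nodup)
    (hA : ∀ a ∈ A₁ ++ A₂, a < b) (hbc : b < c) (hcd : c < d)
    (h : (d :: b :: (A₁ ++ c :: A₂)).Sublist π) :
    ∃ M, b < M ∧ (b :: ((A₁ ++ A₂) ++ [M])).Sublist (psb π) := by
  obtain ⟨l, r', rfl, hd, h'⟩ := List.cons_sublist_iff.1 h
  obtain ⟨l', r, rfl, hb, hr⟩ := List.cons_sublist_iff.1 h'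
  obtain ⟨u, v, rfl⟩ := List.append_of_mem hb
  have hrw : l ++ (u ++ b :: v ++ r) = (l ++ u) ++ b :: (v ++ r) := by simp
  rw [hrw] at hnd ⊢
  have hA' : (A₁ ++ c :: A₂).Sublist (v ++ r) := hr.trans (List.sublist_append_right _ _)
  have hdl : d ∈ l ++ u := List.mem_append_left _ hd
  generalize l ++ u = p at *
  generalize v ++ r = q at *
  have hcq : c ∈ q := hA'.subset (by simp)
  have hcp : c ∉ p := fun hp =>
    (List.nodup_append.1 hnd).2.2 c hp c (List.mem_cons_of_mem _ hcq) rfl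
  have hbq : b ∉ q := (List.nodup_cons.1 (List.nodup_append.1 hnd).2.1).1
  obtain ⟨out, s, hrun, -, hne, -, hgap⟩ := exists_psb_append p
  have hs := hgap c hcp d hdl hcd
  have hs0 : s ≠ [] := hne (List.ne_nil_of_mem hdl)
  rw [hrun]
  rcases s with _ | ⟨t, s⟩
  · exact absurd rfl hs0
  have hct : c < t := hs t (by simp)
  rw [psbAux, if_neg (by omega), if_pos (by omega)]
  obtain ⟨M, hM, hMs⟩ := exists_concat_sublist_psbAux hs0
    (fun y hy => hbc.trans (hs y hy)) hbq hA
    (((List.Sublist.refl A₁).append (List.sublist_cons_self c A₂)).trans hA')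
  exact ⟨M, hM, (hMs.cons_cons b).trans (List.sublist_append_right _ _)⟩

theorem exists_insert_sublist {A l : List ℕ} {c : ℕ} (hA : A.Sublist l) (hcA : c ∉ A)
    (hc : c ∈ l) : ∃ A₁ A₂, A = A₁ ++ A₂ ∧ (A₁ ++ c :: A₂).Sublist l := by
  obtain ⟨u, v, rfl⟩ := List.append_of_mem hc
  obtain ⟨A₁, A₂, rfl, h1, h2⟩ := List.sublist_append_iff.1 hA
  refine ⟨A₁, A₂, rfl, h1.append ?_⟩
  rcases List.sublist_cons_iff.1 h2 with h | ⟨r, rfl, -⟩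
  · exact h.cons_cons c
  · simp at hcA

/-- `π` contains the entries `A` in one of the configurations that make PSB output
some larger value immediately before them. -/
def HasForcing (π A : List ℕ) : Prop :=
  (∃ b c, (∀ a ∈ A, a < b) ∧ b < c ∧ (b :: c :: A).Sublist π) ∨
    ∃ d c b A₁ A₂, A = A₁ ++ A₂ ∧ A₁ ≠ [] ∧ (∀ a ∈ A, a < b) ∧ b < c ∧ c < d ∧
      (d :: b :: (A₁ ++ c :: A₂)).Sublist π

theorem hasForcing_of_sublist_psbAux {π A : List ℕ} {b : ℕ} (hnd : π.Nodup)
    (hconv : ∀ x ∈ π, ∀ z ∈ π, ∀ y, x ≤ y → y ≤ z → y ∈ π)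
    (hA : ∀ a ∈ A, a < b) (hne : A ≠ []) :
    ∀ l p t k, p ++ l = π → (∀ y ∈ List.range' t k, y ∈ p) →
      (t - 1 ∈ p → t ∈ p → [t - 1, t].Sublist p ∨ t = 0) →
      (b :: A).Sublist (psbAux l (List.range' t k)) → HasForcing π A := by
  intro l
  induction l with
  | nil =>
    intro p t k _ _ _ h
    have hs : (b :: A).Pairwise (· < ·) := (List.pairwise_lt_range').sublist h
    obtain ⟨a, ha⟩ := List.exists_mem_of_ne_nil A hne
    have := (List.pairwise_cons.1 hs).1 a ha
    have := hA a ha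
    omega
  | cons x xs ih =>
    intro p t k hp hmem hgap h
    have hp' : (p ++ [x]) ++ xs = π := by simpa using hp
    have hxp : x ∉ p := by
      intro hx
      rw [← hp] at hnd
      exact (List.nodup_append.1 hnd).2.2 x hx x (by simp) rfl
    have hxs : x ∉ xs := by
      rw [← hp] at hnd
      exact (List.nodup_cons.1 (List.nodup_append.1 hnd).2.1).1
    have hnew : x - 1 ∈ p ++ [x] → x ∈ p ++ [x] → [x - 1, x].Sublist (p ++ [x]) ∨ x = 0 := by
      intro h1 _
      rcases Nat.eq_zero_or_pos x with h0 | h0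
      · exact Or.inr h0
      · left
        have : x - 1 ∈ p := by
          rcases List.mem_append.1 h1 with h1 | h1
          · exact h1
          · simp at h1
            omega
        exact (List.singleton_sublist.2 this).append (List.Sublist.refl [x])
    rcases k with _ | k
    · exact ih (p ++ [x]) x 1 hp' (by simp) hnew (by simpa [psbAux] using h)
    have htp : t ∈ p := hmem t (by simp)
    have hmem' : ∀ y ∈ List.range' t (k + 1), y ∈ p ++ [x] := fun y hy =>
      List.mem_append_left _ (hmem y hy)
    rw [List.range'_succ, psbAux] at h
    split_ifs at h with h1 h2
    · subst h1
      refine ih (p ++ [x]) x (k + 2) hp' ?_ hnew (by simpa [List.range'_succ] using h)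
      intro y hy
      rw [List.range'_succ] at hy
      rcases List.mem_cons.1 hy with rfl | hy
      · simp
      · exact hmem' y hy
    · rcases List.sublist_cons_iff.1 h with h | ⟨r, hr, h⟩
      · refine ih (p ++ [x]) t (k + 1) hp' hmem' ?_ (by simpa [List.range'_succ] using h)
        intro h3 h4
        have h3' : t - 1 ∈ p := by
          rcases List.mem_append.1 h3 with h3 | h3
          · exact h3
          · simp at h3
            omega
        exact (hgap h3' htp).imp_left fun h => h.trans (List.sublist_append_left _ _)
      · obtain ⟨rfl, rfl⟩ := List.cons.inj hr
        have hAxs : A.Sublist xs := by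
          refine sublist_of_sublist_psbAux (s := t :: List.range' (t + 1) k) (by simp) ?_ hxs hA h
          intro y hy
          rw [← List.range'_succ, List.mem_range'_1] at hy
          omega
        have hAb : A.Sublist (b :: xs) := hAxs.cons _
        have htπ : t - 1 ∈ π := hconv b (by simp [← hp]) t (by simp [← hp, htp]) _
          (by omega) (by omega)
        rw [← hp] at htπ
        rcases List.mem_append.1 htπ with h3 | h3
        · rcases hgap h3 htp with h4 | h4
          · refine Or.inl ⟨t - 1, t, fun a ha => ?_, by omega, hp ▸ h4.append hAb⟩
            have := hA a ha
            omega
          · omega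
        · have h3' : t - 1 ∈ xs := by
            rcases List.mem_cons.1 h3 with h3 | h3
            · omega
            · exact h3
          obtain ⟨A₁, A₂, rfl, hA12⟩ := exists_insert_sublist hAxs (fun h5 => by
            have := hA _ h5
            omega) h3'
          rcases A₁ with _ | ⟨a, A₁⟩
          · exact Or.inl ⟨b, t - 1, hA, by omega,
              hp ▸ (hA12.cons_cons b).trans (List.sublist_append_right _ _)⟩
          · exact Or.inr ⟨t, t - 1, b, a :: A₁, A₂, rfl, by simp, hA, by omega, by omega,
              hp ▸ (List.singleton_sublist.2 htp).append (hA12.cons_cons b)⟩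
    · rw [← List.range'_succ] at h
      obtain ⟨u, v, huv, hu, hv⟩ := List.sublist_append_iff.1 h
      rcases u with _ | ⟨u, us⟩
      · simp only [List.nil_append] at huv
        subst huv
        exact ih (p ++ [x]) x 1 hp' (by simp) hnew hv
      · simp only [List.cons_append, List.cons.injEq] at huv
        obtain ⟨rfl, rfl⟩ := huv
        have hus : us = [] := by
          by_contra hcon
          obtain ⟨a, ha⟩ := List.exists_mem_of_ne_nil us hcon
          have h3 := (List.pairwise_cons.1 ((List.pairwise_lt_range').sublist hu)).1 a ha
          have h4 := hA a (List.mem_append_left _ ha)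
          omega
        subst hus
        have hb : b ∈ List.range' t (k + 1) := hu.subset (by simp)
        have hbp := hmem b hb
        have hxr : x ∉ List.range' t (k + 1) := fun hx => hxp (hmem x hx)
        rw [List.mem_range'_1] at hb hxr
        have hbx : b < x := by omega
        have hbxs : b ∉ xs := by
          intro hx
          rw [← hp] at hnd
          exact (List.nodup_append.1 hnd).2.2 b hbp b (List.mem_cons_of_mem _ hx) rfl
        have hAxs : v.Sublist xs :=
          sublist_of_sublist_psbAux (by simp) (by simpa using hbx) hbxs hA hv
        exact Or.inl ⟨b, x, hA, hbx, hp ▸ (List.singleton_sublist.2 hbp).append (hAxs.cons_cons x)⟩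

theorem isShuffle_singleton_iff {n : ℕ} {α τ : List ℕ} (hn : n ∉ α) :
    IsShuffle [n] α τ ↔ ∃ α₁ α₂, α = α₁ ++ α₂ ∧ τ = α₁ ++ n :: α₂ := by
  constructor
  · rintro ⟨h1, h2, h3⟩
    obtain ⟨α₁, α₂, rfl, h⟩ := exists_insert_sublist h2 hn (List.singleton_sublist.1 h1)
    exact ⟨α₁, α₂, rfl, (h.eq_of_length (by
      have := h3.length_eq
      simp at this ⊢
      omega)).symm⟩
  · rintro ⟨α₁, α₂, rfl, rfl⟩
    exact ⟨by simp, (List.Sublist.refl α₁).append (List.sublist_cons_self n α₂),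
      List.perm_middle⟩

/-- Extend `f` by the values `b`, `c`, `d` at `n - 1`, `n` and beyond. -/
def extendMap (n : ℕ) (f : ℕ → ℕ) (b c d x : ℕ) : ℕ :=
  if x + 1 < n then f x else if x + 1 = n then b else if x = n then c else d

theorem map_extendMap {n : ℕ} {f : ℕ → ℕ} {b c d : ℕ} {α : List ℕ}
    (hα : ∀ x ∈ α, x + 1 < n) : α.map (extendMap n f b c d) = α.map f :=
  List.map_congr_left fun x hx => if_pos (hα x hx)

theorem extendMap_lt {n : ℕ} {f : ℕ → ℕ} {b c d : ℕ} {α : List ℕ}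
    (hα : ∀ x ∈ α, x + 1 < n) (hf : ∀ x ∈ α, ∀ y ∈ α, x < y → f x < f y)
    (hb : ∀ x ∈ α, f x < b) (hbc : b < c) (hcd : c < d) {x y : ℕ}
    (hx : x ∈ α ∨ x = n - 1 ∨ x = n ∨ x = n + 1) (hy : y ∈ α ∨ y = n - 1 ∨ y = n ∨ y = n + 1)
    (hxy : x < y) : extendMap n f b c d x < extendMap n f b c d y := by
  unfold extendMap
  rcases hx with hx | hx <;> rcases hy with hy | hy
  · have := hf x hx y hy hxy
    have := hα x hx
    have := hα y hy
    split_ifs; omega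
  · have := hα x hx
    have := hb x hx
    split_ifs <;> omega
  · have := hα y hy
    omega
  · split_ifs <;> omega

theorem psb_preimage_class_max_last (n : ℕ) (α : List ℕ)
    (hα : α.Perm (List.range' 1 (n - 2))) (hne : α ≠ []) :
    {π : List ℕ | (∃ m, IsPermList m π) ∧ Avoids (psb π) ((n - 1) :: (α ++ [n]))} =
      {π : List ℕ | (∃ m, IsPermList m π) ∧ Avoids π ((n - 1) :: n :: α) ∧
        ∀ τ : List ℕ, IsShuffle [n] α τ → τ ≠ n :: α →
          Avoids π ((n + 1) :: (n - 1) :: τ)} := by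
  have hlt : ∀ x ∈ α, x + 1 < n := by
    intro x hx
    have := hα.subset hx
    rw [List.mem_range'_1] at this
    omega
  have hn : 3 ≤ n := by
    obtain ⟨a, ha⟩ := List.exists_mem_of_ne_nil α hne
    have := hα.subset ha
    rw [List.mem_range'_1] at this
    omega
  have hnα : n ∉ α := fun h => by
    have := hlt n h
    omega
  have e1 : ∀ f b c d, extendMap n f b c d (n - 1) = b := fun f b c d => by
    simp only [extendMap]
    split_ifs <;> omega
  have e2 : ∀ f b c d, extendMap n f b c d n = c := fun f b c d => by
    simp [extendMap]
  have e3 : ∀ f b c d, extendMap n f b c d (n + 1) = d := fun f b c d => by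
    simp only [extendMap]
    split_ifs <;> omega
  ext π
  simp only [Set.mem_ofPred_eq]
  refine and_congr_right ?_
  rintro ⟨m, hm⟩
  have hnd : π.Nodup := hm.nodup_iff.2 List.nodup_range'
  have hconv : ∀ x ∈ π, ∀ z ∈ π, ∀ y, x ≤ y → y ≤ z → y ∈ π := by
    intro x hx z hz y hxy hyz
    rw [hm.mem_iff, List.mem_range'_1] at *
    omega
  have build : ∀ (f : ℕ → ℕ) b, (∀ x ∈ α, ∀ y ∈ α, x < y → f x < f y) → (∀ x ∈ α, f x < b) →
      (∃ M, b < M ∧ (b :: (α.map f ++ [M])).Sublist (psb π)) →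
      Contains (psb π) ((n - 1) :: (α ++ [n])) := by
    rintro f b hf hb ⟨M, hM, hs⟩
    rw [contains_iff_exists_map]
    refine ⟨extendMap n f b M (M + 1), fun x hx y hy hxy =>
      extendMap_lt hlt hf hb hM (Nat.lt_succ_self M) ?_ ?_ hxy, ?_⟩
    · simp at hx; tauto
    · simp at hy; tauto
    · simpa [e1, e2, map_extendMap hlt] using hs
  constructor
  · intro hav
    refine ⟨fun hcon => hav ?_, fun τ hτ hτne hcon => hav ?_⟩
    · obtain ⟨f, hf, hs⟩ := (contains_iff_exists_map _ _).1 hcon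
      have hb : ∀ x ∈ α, f x < f (n - 1) := fun x hx =>
        hf x (by simp [hx]) _ (by simp) (by have := hlt x hx; omega)
      refine build f (f (n - 1)) (fun x hx y hy => hf x (by simp [hx]) y (by simp [hy])) hb
        (exists_sublist_psb_of_ascent (c := f n) hnd (by simpa using hb)
          (hf _ (by simp) _ (by simp) (by omega)) (by simpa using hs))
    · obtain ⟨α₁, α₂, rfl, rfl⟩ := (isShuffle_singleton_iff hnα).1 hτ
      obtain ⟨f, hf, hs⟩ := (contains_iff_exists_map _ _).1 hcon
      have hmem : ∀ x ∈ α₁ ++ α₂, x ∈ (n + 1) :: (n - 1) :: (α₁ ++ n :: α₂) := by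
        intro x hx
        simp at hx ⊢
        tauto
      have hb : ∀ x ∈ α₁ ++ α₂, f x < f (n - 1) := fun x hx =>
        hf x (hmem x hx) _ (by simp) (by have := hlt x hx; omega)
      refine build f (f (n - 1)) (fun x hx y hy => hf x (hmem x hx) y (hmem y hy)) hb ?_
      rw [List.map_append]
      refine exists_sublist_psb_of_shuffle (c := f n) (d := f (n + 1)) hnd ?_
        (hf _ (by simp) _ (by simp) (by omega)) (hf _ (by simp) _ (by simp) (by omega))
        (by simpa using hs)
      rw [← List.map_append]
      simpa only [List.forall_mem_map] using hb
  · rintro ⟨hav1, hav2⟩ hcon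
    obtain ⟨f, hf, hs⟩ := (contains_iff_exists_map _ _).1 hcon
    have hfα : ∀ x ∈ α, ∀ y ∈ α, x < y → f x < f y := fun x hx y hy =>
      hf x (by simp [hx]) y (by simp [hy])
    have hbs : (f (n - 1) :: α.map f).Sublist (psb π) := by
      refine List.Sublist.trans ?_ hs
      simp
    have hforce : HasForcing π (α.map f) := by
      refine hasForcing_of_sublist_psbAux (b := f (n - 1)) hnd hconv ?_ (by simpa using hne)
        π [] 0 0 rfl (by simp) (by simp) (by simpa [psb] using hbs)
      simp only [List.forall_mem_map]
      exact fun x hx => hf x (by simp [hx]) _ (by simp) (by have := hlt x hx; omega)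
    rcases hforce with ⟨b, c, hb, hbc, hsub⟩ | ⟨d, c, b, A₁, A₂, hA, hA₁, hb, hbc, hcd, hsub⟩
    · simp only [List.forall_mem_map] at hb
      refine hav1 ((contains_iff_exists_map _ _).2 ⟨extendMap n f b c (c + 1),
        fun x hx y hy hxy => extendMap_lt hlt hfα hb hbc (Nat.lt_succ_self c) ?_ ?_ hxy, ?_⟩)
      · simp at hx; tauto
      · simp at hy; tauto
      · simpa [e1, e2, map_extendMap hlt] using hsub
    · simp only [List.forall_mem_map] at hb
      obtain ⟨α₁, α₂, rfl, rfl, rfl⟩ := List.map_eq_append_iff.1 hA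
      refine hav2 (α₁ ++ n :: α₂) ((isShuffle_singleton_iff hnα).2 ⟨α₁, α₂, rfl, rfl⟩) ?_
        ((contains_iff_exists_map _ _).2 ⟨extendMap n f b c d,
        fun x hx y hy hxy => extendMap_lt hlt hfα hb hbc hcd ?_ ?_ hxy, ?_⟩)
      · rcases α₁ with _ | ⟨a, α₁⟩
        · simp at hA₁
        · intro h
          simp only [List.cons_append, List.cons.injEq] at h
          exact hnα (by simp [h.1])
      · simp at hx ⊢; tauto
      · simp at hy ⊢; tauto
      · have h1 := map_extendMap (f := f) (b := b) (c := c) (d := d)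
          fun x (hx : x ∈ α₁) => hlt x (List.mem_append_left _ hx)
        have h2 := map_extendMap (f := f) (b := b) (c := c) (d := d)
          fun x (hx : x ∈ α₂) => hlt x (List.mem_append_right _ hx)
        simpa [e1, e2, e3, h1, h2] using hsub
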